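/- arXiv:2106.03554 — 2 statements merged into one kernel-verified Lean document; each statement's English description precedes it below -/
import Mathlib

section
/- In a marked proper free-choice net having a home cluster, no reachable marking strictly dominates another reachable marking: for all M1, M2 ∈ R(N,M), M1 is not strictly greater than M2 as a multiset. Consequently, (N,M) is bounded. -/
open scoped Classical

/-- A Petri net over places `P` and transitions `T`, given by preset and postset
of each transition (this encodes the flow relation `F`). -/
structure PetriNet (P T : Type) where
  pre : T → Finset P
  post : T → Finset P

namespace PetriNet

variable {P T : Type} [DecidableEq P] (N : PetriNet P T)

/-- A transition is enabled if each input place holds at least one token. -/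
def enabled (M : P → ℕ) (t : T) : Prop := ∀ p ∈ N.pre t, 1 ≤ M p

/-- Firing a transition. -/
def fire (M : P → ℕ) (t : T) : P → ℕ :=
  fun p => M p - (if p ∈ N.pre t then 1 else 0) + (if p ∈ N.post t then 1 else 0)

/-- `Fires M σ M'` : the firing sequence σ is enabled in M and leads to M'. -/
inductive Fires : (P → ℕ) → List T → (P → ℕ) → Prop
  | nil (M : P → ℕ) : Fires M [] M
  | cons {M : P → ℕ} {t : T} {σ : List T} {M'' : P → ℕ} :
      N.enabled M t → Fires (N.fire M t) σ M'' → Fires M (t :: σ) M''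

/-- Reachability of markings. -/
def Reach (M M' : P → ℕ) : Prop := ∃ σ : List T, N.Fires M σ M'

/-- The set of transitions enabled in a marking. -/
def en (M : P → ℕ) : Set T := {t | N.enabled M t}

/-- Lucency: reachable markings are determined by their sets of enabled transitions. -/
def Lucent (M : P → ℕ) : Prop :=
  ∀ M1 M2 : P → ℕ, N.Reach M M1 → N.Reach M M2 → N.en M1 = N.en M2 → M1 = M2

/-- Free-choice: presets of any two transitions are equal or disjoint. -/
def FreeChoice : Prop :=
  ∀ t1 t2 : T, N.pre t1 = N.pre t2 ∨ N.pre t1 ∩ N.pre t2 = ∅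

/-- Proper: every transition has a nonempty preset and postset. -/
def Proper : Prop := ∀ t : T, (N.pre t).Nonempty ∧ (N.post t).Nonempty

/-- The directed edge (flow) relation on nodes `P ⊕ T`. -/
def edge : (P ⊕ T) → (P ⊕ T) → Prop
  | Sum.inl p, Sum.inr t => p ∈ N.pre t
  | Sum.inr t, Sum.inl p => p ∈ N.post t
  | _, _ => False

/-- `InCluster x y` : y is in the cluster of x (smallest set containing x closed
under adding output transitions of places and input places of transitions). -/
inductive InCluster : (P ⊕ T) → (P ⊕ T) → Prop
  | refl (x : P ⊕ T) : InCluster x x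
  | toTrans {x : P ⊕ T} {p : P} {t : T} :
      InCluster x (Sum.inl p) → p ∈ N.pre t → InCluster x (Sum.inr t)
  | toPlace {x : P ⊕ T} {t : T} {p : P} :
      InCluster x (Sum.inr t) → p ∈ N.pre t → InCluster x (Sum.inl p)

/-- The cluster of a node. -/
def cluster (x : P ⊕ T) : Set (P ⊕ T) := {y | N.InCluster x y}

/-- A set of nodes is a cluster if it is the cluster of some node. -/
def IsCluster (C : Set (P ⊕ T)) : Prop := ∃ x : P ⊕ T, C = N.cluster x

/-- `Mrk(C)` : one token on each place of `C`, no tokens elsewhere. -/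
noncomputable def clusterMrk (C : Set (P ⊕ T)) : P → ℕ :=
  fun p => if Sum.inl p ∈ C then 1 else 0

/-- A home marking is reachable from every reachable marking. -/
def IsHomeMarking (M MH : P → ℕ) : Prop := ∀ M', N.Reach M M' → N.Reach M' MH

/-- A home cluster is a cluster whose marking `Mrk(C)` is a home marking. -/
def HomeCluster (M : P → ℕ) (C : Set (P ⊕ T)) : Prop :=
  N.IsCluster C ∧ N.IsHomeMarking M (clusterMrk C)

/-- A conflict-pair for `(N,M)`. -/
def ConflictPair (M M1 M2 : P → ℕ) : Prop :=
  N.Reach M M1 ∧ N.Reach M M2 ∧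
  (∃ t, N.enabled M1 t) ∧ (∃ t, N.enabled M2 t) ∧
  (∀ t, ¬ (N.enabled M1 t ∧ N.enabled M2 t)) ∧
  (∀ t, N.enabled M1 t → ∃ p ∈ N.pre t, 1 ≤ M2 p) ∧
  (∀ t, N.enabled M2 t → ∃ p ∈ N.pre t, 1 ≤ M1 p)

/-- A disentangled path `⟨p_1,t_1,p_2,…,t_{n-1},p_n⟩`, given by its lists of
places and transitions: consecutive nodes are connected by the flow relation and
all places lie in pairwise distinct clusters. -/
def IsDisPath (ps : List P) (ts : List T) : Prop :=
  ps.length = ts.length + 1 ∧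
  (∀ (i : ℕ) (t : T) (p p' : P), ts[i]? = some t → ps[i]? = some p →
      ps[i + 1]? = some p' → p ∈ N.pre t ∧ p' ∈ N.post t) ∧
  ps.Pairwise (fun a b => N.cluster (Sum.inl a) ≠ N.cluster (Sum.inl b))

/-- `Exp M σ σ'` : σ' is obtained from σ by repeatedly expediting transitions
(moving the transition at position j to an earlier position i, provided the
prefix of length i followed by that transition is enabled from M and no
transition at positions i..j-1 shares its cluster). -/
inductive Exp (M : P → ℕ) (σ : List T) : List T → Prop
  | refl : Exp M σ σ
  | step {σ' : List T} {i j : ℕ} (h : Exp M σ σ') (hij : i < j) (hj : j < σ'.length)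
      (ha : ∃ Mx, N.Fires M (σ'.take i ++ [σ'.get ⟨j, hj⟩]) Mx)
      (hb : ∀ (k : ℕ) (hk : k < σ'.length), i ≤ k → k < j →
        N.cluster (Sum.inr (σ'.get ⟨k, hk⟩)) ≠ N.cluster (Sum.inr (σ'.get ⟨j, hj⟩))) :
      Exp M σ ((σ'.eraseIdx j).insertIdx i (σ'.get ⟨j, hj⟩))

/-- Liveness: from every reachable marking, every transition can be enabled again. -/
def Live (M : P → ℕ) : Prop :=
  ∀ M', N.Reach M M' → ∀ t : T, ∃ M'', N.Reach M' M'' ∧ N.enabled M'' t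

/-- Boundedness. -/
def Bounded (M : P → ℕ) : Prop :=
  ∃ k, ∀ M', N.Reach M M' → ∀ p, M' p ≤ k

/-- Safety (1-boundedness). -/
def Safe (M : P → ℕ) : Prop := ∀ M', N.Reach M M' → ∀ p, M' p ≤ 1

end PetriNet

namespace PetriNet

theorem aux_fires_append {P T : Type} [DecidableEq P] (N : PetriNet P T) {A B D : P → ℕ}
    {σ τ : List T} (h : N.Fires A σ B) (h2 : N.Fires B τ D) : N.Fires A (σ ++ τ) D := by
  induction h with
  | nil => exact h2
  | cons he _ ih => exact Fires.cons he (ih h2)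

theorem aux_reach_fire {P T : Type} [DecidableEq P] (N : PetriNet P T) {A B : P → ℕ} {t : T}
    (h : N.Reach A B) (ht : N.enabled B t) : N.Reach A (N.fire B t) := by
  obtain ⟨σ, hσ⟩ := h
  exact ⟨σ ++ [t], N.aux_fires_append hσ (Fires.cons ht (Fires.nil _))⟩

theorem aux_persist {P T : Type} [DecidableEq P] (N : PetriNet P T) {A A' : P → ℕ} {σ : List T}
    (h : N.Fires A σ A') (p : P) (hn : ∀ t ∈ σ, p ∉ N.pre t) : A p ≤ A' p := by
  induction h with
  | nil => exact le_rfl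
  | cons he _ ih =>
    refine le_trans ?_ (ih fun t ht => hn t (List.mem_cons_of_mem _ ht))
    have := hn _ List.mem_cons_self
    simp [fire, this]

theorem aux_ne {P T : Type} [DecidableEq P] (N : PetriNet P T) (hp : N.Proper)
    {A A' H : P → ℕ} {σ : List T} (h : N.Fires A σ A') (hle : ∀ p, H p ≤ A p) (hne : A ≠ H)
    (hn : ∀ t ∈ σ, ∀ p ∈ N.pre t, H p = 0) : A' ≠ H := by
  induction h with
  | nil => exact hne
  | @cons A t σ A'' he _ ih =>
    have h0 := hn t List.mem_cons_self
    refine ih ?_ ?_ fun s hs => hn s (List.mem_cons_of_mem _ hs)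
    · intro p
      by_cases hpp : p ∈ N.pre t
      · simp [h0 p hpp]
      · have := hle p
        simp only [fire, hpp, if_false]; omega
    · intro heq
      obtain ⟨q, hq⟩ := (hp t).2
      have h1 := congrFun heq q
      have h2 := hle q
      by_cases hpp : q ∈ N.pre t
      · have := h0 q hpp
        simp [fire, hpp, hq] at h1; omega
      · simp [fire, hpp, hq] at h1; omega

theorem aux_expedite {P T : Type} [DecidableEq P] (N : PetriNet P T) (hfc : N.FreeChoice)
    {A A' : P → ℕ} {σ : List T} {t : T} (h : N.Fires A σ A') (ht : N.enabled A t)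
    (hex : ∃ u ∈ σ, N.pre u = N.pre t) :
    ∃ u σ', N.pre u = N.pre t ∧ N.Fires (N.fire A u) σ' A' ∧ σ'.length < σ.length := by
  induction h with
  | nil => simp at hex
  | @cons A s σ A'' he hf ih =>
    by_cases hs : N.pre s = N.pre t
    · exact ⟨s, σ, hs, hf, by simp⟩
    have hd : ∀ p, p ∈ N.pre s → p ∉ N.pre t := by
      intro p h1 h2
      rcases hfc s t with h | h
      · exact hs h
      · have : p ∈ N.pre s ∩ N.pre t := Finset.mem_inter.2 ⟨h1, h2⟩
        rw [h] at this; simp at this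
    have ht' : N.enabled (N.fire A s) t := by
      intro p hpt
      have h1 : p ∉ N.pre s := fun h => hd p h hpt
      have := ht p hpt
      simp only [fire, h1, if_false]; omega
    have hex' : ∃ u ∈ σ, N.pre u = N.pre t := by
      obtain ⟨u, hu, hut⟩ := hex
      rcases List.mem_cons.1 hu with rfl | hu
      · exact absurd hut hs
      · exact ⟨u, hu, hut⟩
    obtain ⟨u, σ', hu, hfu, hl⟩ := ih ht' hex'
    refine ⟨u, s :: σ', hu, Fires.cons ?_ ?_, by simpa using hl⟩
    · intro p hps
      have h1 : p ∉ N.pre u := hu ▸ hd p hps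
      have := he p hps
      simp only [fire, h1, if_false]; omega
    · have : N.fire (N.fire A u) s = N.fire (N.fire A s) u := by
        funext p
        by_cases h1 : p ∈ N.pre s
        · have h2 : p ∉ N.pre u := hu ▸ hd p h1
          have := he p h1
          simp only [fire, h1, h2, if_false, if_true]; omega
        · by_cases h2 : p ∈ N.pre u
          · have := ht p (hu ▸ h2)
            simp only [fire, h1, h2, if_false, if_true]; omega
          · simp only [fire, h1, h2, if_false]; omega
      rw [this]; exact hfu

/-- `y` belongs to the cluster determined by the transition `t`. -/
def AuxQ {P T : Type} (N : PetriNet P T) (t : T) : P ⊕ T → Prop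
  | Sum.inl q => q ∈ N.pre t
  | Sum.inr u => N.pre u = N.pre t

theorem auxQ_iff {P T : Type} [DecidableEq P] (N : PetriNet P T) (hfc : N.FreeChoice) (t : T)
    (p : P) (u : T) (h : p ∈ N.pre u) : AuxQ N t (Sum.inl p) ↔ AuxQ N t (Sum.inr u) := by
  constructor
  · intro h1
    rcases hfc u t with h2 | h2
    · exact h2
    · have : p ∈ N.pre u ∩ N.pre t := Finset.mem_inter.2 ⟨h, h1⟩
      rw [h2] at this; simp at this
  · intro h1
    have h1 : N.pre u = N.pre t := h1
    show p ∈ N.pre t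
    exact h1 ▸ h

theorem auxQ_cluster {P T : Type} [DecidableEq P] (N : PetriNet P T) (hfc : N.FreeChoice) (t : T)
    {x y : P ⊕ T} (h : N.InCluster x y) : AuxQ N t x ↔ AuxQ N t y := by
  induction h with
  | refl => exact Iff.rfl
  | toTrans _ hm ih => exact ih.trans (N.auxQ_iff hfc t _ _ hm)
  | toPlace _ hm ih => exact ih.trans (N.auxQ_iff hfc t _ _ hm).symm

theorem aux_main {P T : Type} [DecidableEq P] (N : PetriNet P T) (M : P → ℕ) (C : Set (P ⊕ T))
    (hp : N.Proper) (hfc : N.FreeChoice) (hc : N.HomeCluster M C) (n : ℕ) :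
    ∀ (σ : List T), σ.length < n → ∀ (A B : P → ℕ), N.Reach M B → (∀ p, B p ≤ A p) → A ≠ B →
      N.Fires A σ (clusterMrk C) → False := by
  obtain ⟨⟨x, rfl⟩, hh⟩ := hc
  have hpre : ∀ t p q, p ∈ N.pre t → Sum.inl p ∈ N.cluster x →
      (q ∈ N.pre t ↔ Sum.inl q ∈ N.cluster x) := by
    intro t p q h1 h2
    constructor
    · intro h3
      exact InCluster.toPlace (InCluster.toTrans h2 h1) h3
    · intro h3
      exact (N.auxQ_cluster hfc t h3).1 ((N.auxQ_cluster hfc t h2).2 h1)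
  have hmem : ∀ p, 1 ≤ clusterMrk (N.cluster x) p ↔ Sum.inl p ∈ N.cluster x := by
    intro p; unfold clusterMrk; split_ifs with h <;> simp [h]
  have hle1 : ∀ p, clusterMrk (N.cluster x) p ≤ 1 := by
    intro p; unfold clusterMrk; split_ifs <;> simp
  induction n with
  | zero =>
    intro σ hl A B hB hle hne hf
    exact absurd hl (by omega)
  | succ n ih =>
    intro σ hl A B hB hle hne hf
    by_cases hd : ∃ t, N.enabled B t
    · obtain ⟨t, ht⟩ := hd
      have htA : N.enabled A t := fun p h => (ht p h).trans (hle p)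
      by_cases hex : ∃ u ∈ σ, N.pre u = N.pre t
      · obtain ⟨u, σ', hu, hf', hl'⟩ := N.aux_expedite hfc hf htA hex
        have huB : N.enabled B u := fun p h => ht p (hu ▸ h)
        refine ih σ' (by omega) (N.fire A u) (N.fire B u) (N.aux_reach_fire hB huB) ?_ ?_ hf'
        · intro p
          have := hle p
          unfold fire; omega
        · intro heq
          apply hne
          funext p
          have h1 := congrFun heq p
          have h2 := hle p
          by_cases h3 : p ∈ N.pre u
          · have := huB p h3
            simp only [fire, h3, if_true] at h1; omega
          · simp only [fire, h3, if_false] at h1; omega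
      · have hdis : ∀ s ∈ σ, ∀ p ∈ N.pre t, p ∉ N.pre s := by
          intro s hs p h1 h2
          rcases hfc s t with h | h
          · exact hex ⟨s, hs, h⟩
          · have : p ∈ N.pre s ∩ N.pre t := Finset.mem_inter.2 ⟨h2, h1⟩
            rw [h] at this; simp at this
        have hin : ∀ p ∈ N.pre t, Sum.inl p ∈ N.cluster x := by
          intro p h1
          rw [← hmem]
          exact (htA p h1).trans (N.aux_persist hf p fun s hs => hdis s hs p h1)
        obtain ⟨p0, hp0⟩ := (hp t).1
        have hBH : ∀ p, clusterMrk (N.cluster x) p ≤ B p := by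
          intro p
          by_cases h : Sum.inl p ∈ N.cluster x
          · exact (hle1 p).trans (ht p ((hpre t p0 p hp0 (hin p0 hp0)).2 h))
          · have := mt (hmem p).1 h
            omega
        refine N.aux_ne hp hf (fun p => (hBH p).trans (hle p)) ?_ ?_ rfl
        · intro heq
          apply hne
          funext p
          have h1 := congrFun heq p
          have h2 := hle p
          have h3 := hBH p
          omega
        · intro s hs p h1
          by_contra h
          have h2 : Sum.inl p ∈ N.cluster x := (hmem p).1 (by omega)
          exact hdis s hs p ((hpre t p0 p hp0 (hin p0 hp0)).2 h2) h1
    · have hBH : B = clusterMrk (N.cluster x) := by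
        obtain ⟨τ, hτ⟩ := hh B hB
        cases hτ with
        | nil => rfl
        | cons he _ => exact absurd ⟨_, he⟩ hd
      refine N.aux_ne hp hf (fun p => hBH ▸ hle p) (hBH ▸ hne) ?_ rfl
      intro s hs p h1
      by_contra h
      have h2 : Sum.inl p ∈ N.cluster x := (hmem p).1 (by omega)
      refine hd ⟨s, fun q hq => ?_⟩
      rw [hBH, hmem]
      exact (hpre s p q h1 h2).1 hq

end PetriNet

/-- In a marked proper free-choice net with a home cluster, no
reachable marking strictly dominates another one; consequently the net is
bounded. -/
theorem no_strict_domination_and_bounded {P T : Type} [DecidableEq P] [Fintype P]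
    (N : PetriNet P T) (M : P → ℕ) (C : Set (P ⊕ T))
    (hp : N.Proper) (hfc : N.FreeChoice) (hc : N.HomeCluster M C) :
    (∀ M1 M2, N.Reach M M1 → N.Reach M M2 →
      ¬ ((∀ p, M2 p ≤ M1 p) ∧ M1 ≠ M2)) ∧
    N.Bounded M := by
  have key : ∀ M1 M2, N.Reach M M1 → N.Reach M M2 →
      ¬ ((∀ p, M2 p ≤ M1 p) ∧ M1 ≠ M2) := by
    rintro M1 M2 h1 h2 ⟨hle, hne⟩
    obtain ⟨σ, hσ⟩ := hc.2 M1 h1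
    exact N.aux_main M C hp hfc hc (σ.length + 1) σ (by omega) M1 M2 h2 hle hne hσ
  refine ⟨key, ?_⟩
  have hanti : IsAntichain (· ≤ ·) {M' | N.Reach M M'} := by
    intro A hA B hB hne hle
    exact key B A hB hA ⟨hle, hne.symm⟩
  have hfin : {M' | N.Reach M M'}.Finite :=
    hanti.finite_of_partiallyWellOrderedOn (Set.isPWO_of_wellQuasiOrderedLE _)
  obtain ⟨K, hK⟩ := hfin.bddAbove
  refine ⟨∑ p, K p, fun M' h p => (hK h p).trans ?_⟩
  exact Finset.single_le_sum (f := K) (fun _ _ => Nat.zero_le _) (Finset.mem_univ p)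
end

section
/- In a marked proper free-choice net (N,M) with a home cluster C, every C-rooted disentangled path is safe: for every reachable marking M' and every C-rooted disentangled path ρ = ⟨p_1,t_1,...,t_{n-1},p_n⟩, the total number of tokens of M' on the places {p_1,...,p_n} is at most 1. -/
open scoped Classical

namespace PetriNet

section Helpers

variable {P T : Type} [DecidableEq P] {N : PetriNet P T}

theorem InCluster.trans' {x y z : P ⊕ T} (h1 : N.InCluster x y) (h2 : N.InCluster y z) :
    N.InCluster x z := by
  induction h2 with
  | refl => exact h1
  | toTrans _ hp ih => exact InCluster.toTrans ih hp
  | toPlace _ hp ih => exact InCluster.toPlace ih hp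

theorem InCluster.symm' {x y : P ⊕ T} (h : N.InCluster x y) : N.InCluster y x := by
  induction h with
  | refl => exact InCluster.refl _
  | toTrans _ hp ih => exact InCluster.trans' (InCluster.toPlace (InCluster.refl _) hp) ih
  | toPlace _ hp ih => exact InCluster.trans' (InCluster.toTrans (InCluster.refl _) hp) ih

theorem cluster_eq {x y : P ⊕ T} (h : N.InCluster x y) : N.cluster x = N.cluster y := by
  ext z
  exact ⟨fun hz => h.symm'.trans' hz, fun hz => h.trans' hz⟩

theorem not_pre_of_ne {a b : P} {t : T} (h : N.cluster (Sum.inl a) ≠ N.cluster (Sum.inl b))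
    (ha : a ∈ N.pre t) : b ∉ N.pre t := fun hb =>
  h (cluster_eq (InCluster.toPlace (InCluster.toTrans (InCluster.refl _) ha) hb))

theorem not_mem_of_ne {C : Set (P ⊕ T)} (hC : N.IsCluster C) {a b : P}
    (h : N.cluster (Sum.inl a) ≠ N.cluster (Sum.inl b))
    (hb : Sum.inl b ∈ C) : Sum.inl a ∉ C := by
  obtain ⟨x, rfl⟩ := hC
  intro ha
  have ha' : N.InCluster x (Sum.inl a) := ha
  have hb' : N.InCluster x (Sum.inl b) := hb
  exact h (cluster_eq (ha'.symm'.trans' hb'))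

theorem pre_eq (hfc : N.FreeChoice) {t u : T} {p : P} (h1 : p ∈ N.pre t) (h2 : p ∈ N.pre u) :
    N.pre t = N.pre u := by
  rcases hfc t u with h | h
  · exact h
  · exfalso
    have : p ∈ N.pre t ∩ N.pre u := Finset.mem_inter.2 ⟨h1, h2⟩
    rw [h] at this
    simp at this

/-- invariant describing the cluster of `t` -/
def phi (N : PetriNet P T) (t : T) : P ⊕ T → Prop
  | Sum.inl q => q ∈ N.pre t
  | Sum.inr u => N.pre u = N.pre t

theorem phi_iff (hfc : N.FreeChoice) (t : T) {x y : P ⊕ T} (h : N.InCluster x y) :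
    phi N t x ↔ phi N t y := by
  have key : ∀ (p : P) (u : T), p ∈ N.pre u → (p ∈ N.pre t ↔ N.pre u = N.pre t) := by
    intro p u hp
    exact ⟨fun h => pre_eq hfc hp h, fun h => h ▸ hp⟩
  induction h with
  | refl => exact Iff.rfl
  | toTrans _ hp ih => exact ih.trans (key _ _ hp)
  | toPlace _ hp ih => exact ih.trans (key _ _ hp).symm

/-- If one input place of `t` is in the cluster `C`, the places of `C` are exactly `pre t`. -/
theorem mem_cluster_iff (hfc : N.FreeChoice) {C : Set (P ⊕ T)} (hC : N.IsCluster C)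
    {t : T} {p : P} (hp : p ∈ N.pre t) (hpC : Sum.inl p ∈ C) (q : P) :
    Sum.inl q ∈ C ↔ q ∈ N.pre t := by
  obtain ⟨x, rfl⟩ := hC
  have h1 : N.InCluster x (Sum.inl p) := hpC
  constructor
  · intro hq
    have h2 : N.InCluster x (Sum.inl q) := hq
    exact (phi_iff hfc t (h1.symm'.trans' h2)).1 hp
  · intro hq
    exact InCluster.toPlace (InCluster.toTrans h1 hp) hq

theorem Fires.append' {M1 M2 M3 : P → ℕ} {a b : List T} (h1 : N.Fires M1 a M2)
    (h2 : N.Fires M2 b M3) : N.Fires M1 (a ++ b) M3 := by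
  induction h1 with
  | nil => exact h2
  | cons he _ ih => exact Fires.cons he (ih h2)

theorem Reach.trans' {M1 M2 M3 : P → ℕ} (h1 : N.Reach M1 M2) (h2 : N.Reach M2 M3) :
    N.Reach M1 M3 := by
  obtain ⟨a, ha⟩ := h1
  obtain ⟨b, hb⟩ := h2
  exact ⟨_, ha.append' hb⟩

theorem reach_fire {M1 : P → ℕ} {t : T} (h : N.enabled M1 t) : N.Reach M1 (N.fire M1 t) :=
  ⟨[t], Fires.cons h (Fires.nil _)⟩

theorem le_fire {X : P → ℕ} {t : T} {p : P} (h : p ∉ N.pre t) : X p ≤ N.fire X t p := by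
  unfold fire
  simp [h]

theorem lt_fire {X : P → ℕ} {t : T} {p : P} (h : p ∉ N.pre t) (h2 : p ∈ N.post t) :
    X p + 1 ≤ N.fire X t p := by
  unfold fire
  simp [h, h2]

theorem one_le_fire {X : P → ℕ} {t : T} {p : P} (h2 : p ∈ N.post t) :
    1 ≤ N.fire X t p := by
  unfold fire
  simp [h2]

theorem pred_le_fire {X : P → ℕ} {t : T} {p : P} : X p ≤ N.fire X t p + 1 := by
  unfold fire
  split_ifs <;> omega

theorem fire_comm {X : P → ℕ} {t u : T} (ht : N.enabled X t) (hu : N.enabled X u)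
    (hd : ∀ p, p ∈ N.pre u → p ∉ N.pre t) :
    N.fire (N.fire X t) u = N.fire (N.fire X u) t := by
  funext p
  have h1 := ht p
  have h2 := hu p
  have h3 := hd p
  unfold fire
  by_cases a : p ∈ N.pre t <;> by_cases b : p ∈ N.pre u <;> simp_all <;> omega

theorem enabled_fire {X : P → ℕ} {t u : T} (hu : N.enabled X u)
    (hd : ∀ p, p ∈ N.pre u → p ∉ N.pre t) : N.enabled (N.fire X t) u := fun p hp =>
  (hu p hp).trans (le_fire (hd p hp))

theorem fires_front {t : T} {b : List T} {Y : P → ℕ} (a : List T) : ∀ {X : P → ℕ},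
    N.Fires X (a ++ t :: b) Y → N.enabled X t →
    (∀ u ∈ a, ∀ p, p ∈ N.pre u → p ∉ N.pre t) → N.Fires (N.fire X t) (a ++ b) Y := by
  induction a with
  | nil =>
    intro X h _ _
    cases h with
    | cons _ h => exact h
  | cons u a ih =>
    intro X h ht hd
    cases h with
    | cons hu h =>
      have hdu := hd u (by simp)
      have h' := ih h (enabled_fire ht (fun p hp hp' => hdu p hp' hp))
        (fun v hv => hd v (by simp [hv]))
      refine Fires.cons (enabled_fire hu hdu) ?_
      rw [fire_comm ht hu hdu]
      exact h'

theorem fire_add {M1 K : P → ℕ} {t : T} (h : N.enabled M1 t) :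
    N.fire (fun p => M1 p + K p) t = fun p => N.fire M1 t p + K p := by
  funext p
  have := h p
  unfold fire
  by_cases a : p ∈ N.pre t <;> simp_all <;> omega

theorem exists_first (Q : T → Prop) (l : List T) : (∀ t ∈ l, ¬ Q t) ∨
    ∃ a t b, l = a ++ t :: b ∧ Q t ∧ ∀ u ∈ a, ¬ Q u := by
  induction l with
  | nil => left; simp
  | cons x l ih =>
    by_cases hx : Q x
    · exact Or.inr ⟨[], x, l, rfl, hx, by simp⟩
    · rcases ih with h | ⟨a, t, b, rfl, ht, ha⟩
      · left
        intro t ht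
        rcases List.mem_cons.1 ht with rfl | h'
        · exact hx
        · exact h t h'
      · refine Or.inr ⟨x :: a, t, b, rfl, ht, ?_⟩
        intro u hu
        rcases List.mem_cons.1 hu with rfl | h'
        · exact hx
        · exact ha u h'

theorem fires_le {p : P} {X Y : P → ℕ} {l : List T} (h : N.Fires X l Y)
    (hl : ∀ t ∈ l, p ∉ N.pre t) : X p ≤ Y p := by
  induction h with
  | nil => exact le_rfl
  | cons _ _ ih =>
    exact (le_fire (hl _ (by simp))).trans (ih fun t ht => hl t (by simp [ht]))

/-- Firing only transitions that do not consume from `C` keeps a marking strictly above `Mrk(C)`. -/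
theorem fires_above (hp : N.Proper) {C : Set (P ⊕ T)} {X Y : P → ℕ} {l : List T}
    (h : N.Fires X l Y) (hl : ∀ t ∈ l, ∀ p ∈ N.pre t, Sum.inl p ∉ C)
    (h1 : ∀ p, clusterMrk C p ≤ X p) (h2 : X ≠ clusterMrk C) : Y ≠ clusterMrk C := by
  induction h with
  | nil => exact h2
  | @cons X t σ Y he _ ih =>
    have ht := hl t (by simp)
    have hge : ∀ p, clusterMrk C p ≤ N.fire X t p := by
      intro p
      by_cases hpC : (Sum.inl p : P ⊕ T) ∈ C
      · exact (h1 p).trans (le_fire fun hpt => ht p hpt hpC)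
      · simp [clusterMrk, hpC]
    refine ih (fun t ht => hl t (by simp [ht])) hge ?_
    intro heq
    obtain ⟨q, hq⟩ := (hp t).2
    have hqe := congrFun heq q
    by_cases hqC : (Sum.inl q : P ⊕ T) ∈ C
    · have := lt_fire (X := X) (fun hpt => ht q hpt hqC) hq
      have := h1 q
      omega
    · have := one_le_fire (X := X) hq
      simp [clusterMrk, hqC] at hqe
      omega

theorem cover_of_enabled (hfc : N.FreeChoice) {C : Set (P ⊕ T)} (hC : N.IsCluster C)
    {X : P → ℕ} {t : T} {p : P} (he : N.enabled X t) (hp : p ∈ N.pre t)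
    (hpC : Sum.inl p ∈ C) (q : P) : clusterMrk C q ≤ X q := by
  by_cases hq : (Sum.inl q : P ⊕ T) ∈ C
  · simp only [clusterMrk, hq, if_true]
    exact he q ((mem_cluster_iff hfc hC hp hpC q).1 hq)
  · simp [clusterMrk, hq]

theorem no_extra_aux (hp : N.Proper) (hfc : N.FreeChoice) {M : P → ℕ} {C : Set (P ⊕ T)}
    (hc : N.HomeCluster M C) {K : P → ℕ} {k : P} (hK : 1 ≤ K k) (M1 : P → ℕ)
    (l : List T) (hr : N.Reach M M1) (hf : N.Fires (fun p => M1 p + K p) l (clusterMrk C))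
    (hl : ∀ t ∈ l, ¬ N.enabled M1 t) : False := by
  have hcov : ∀ p, clusterMrk C p ≤ M1 p := by
    obtain ⟨τ, hτ⟩ := hc.2 M1 hr
    generalize hZ : clusterMrk C = Z at hτ
    cases hτ with
    | nil => exact fun p => le_rfl
    | @cons _ s σ _ hs _ =>
      subst hZ
      obtain ⟨p, hps⟩ := (hp s).1
      have h1 : M1 p + K p ≤ clusterMrk C p := fires_le hf (by
        intro t ht hpt
        apply hl t ht
        unfold enabled
        rw [pre_eq hfc hpt hps]
        exact hs)
      have h2 := hs p hps
      have hpC : (Sum.inl p : P ⊕ T) ∈ C := by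
        by_contra hcon
        simp [clusterMrk, hcon] at h1
        omega
      exact cover_of_enabled hfc hc.1 hs hps hpC
  refine fires_above hp hf ?_ (fun p => (hcov p).trans (Nat.le_add_right _ _)) ?_ rfl
  · intro t ht p hpt hpC
    apply hl t ht
    intro q hq
    have h1 := hcov q
    have h2 := (mem_cluster_iff hfc hc.1 hpt hpC q).2 hq
    simpa [clusterMrk, h2] using h1
  · intro heq
    have h1 := congrFun heq k
    have h2 := hcov k
    omega

theorem no_extra (hp : N.Proper) (hfc : N.FreeChoice) {M : P → ℕ} {C : Set (P ⊕ T)}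
    (hc : N.HomeCluster M C) {K : P → ℕ} {k : P} (hK : 1 ≤ K k) : ∀ (n : ℕ) (M1 : P → ℕ)
    (l : List T), l.length = n → N.Reach M M1 →
    N.Fires (fun p => M1 p + K p) l (clusterMrk C) → False := by
  intro n
  induction n with
  | zero =>
    intro M1 l hn hr hf
    exact no_extra_aux hp hfc hc hK M1 l hr hf (by
      obtain rfl := List.eq_nil_of_length_eq_zero hn
      simp)
  | succ n ih =>
    intro M1 l hn hr hf
    rcases exists_first (fun t => N.enabled M1 t) l with h | ⟨a, t, b, rfl, ht, ha⟩
    · exact no_extra_aux hp hfc hc hK M1 l hr hf h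
    · have hf' := fires_front a hf (fun p hp => (ht p hp).trans (Nat.le_add_right _ _)) (by
        intro u hu p hpu hpt
        apply ha u hu
        unfold enabled
        rw [pre_eq hfc hpu hpt]
        exact ht)
      rw [fire_add ht] at hf'
      refine ih _ (a ++ b) ?_ (hr.trans' (reach_fire ht)) hf'
      simp at hn ⊢
      omega

/-- A reachable marking covering `Mrk(C)` equals `Mrk(C)`. -/
theorem eq_of_cover (hp : N.Proper) (hfc : N.FreeChoice) {M : P → ℕ} {C : Set (P ⊕ T)}
    (hc : N.HomeCluster M C) {X : P → ℕ} (hr : N.Reach M X)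
    (hX : ∀ p, clusterMrk C p ≤ X p) (k : P) : X k = clusterMrk C k := by
  by_contra hne
  obtain ⟨l, hl⟩ := hc.2 X hr
  have hk := hX k
  refine no_extra hp hfc hc (K := fun p => X p - clusterMrk C p) (k := k) (by
    show 1 ≤ X k - clusterMrk C k
    omega) l.length (clusterMrk C) l rfl (hr.trans' ⟨l, hl⟩) ?_
  have : (fun p => clusterMrk C p + (X p - clusterMrk C p)) = X := by
    funext p
    have := hX p
    omega
  rw [this]
  exact hl

/-- Run towards `Mrk(C)` until a transition consuming from `L` is about to fire. -/
theorem advance {M : P → ℕ} {C : Set (P ⊕ T)} (hc : N.HomeCluster M C) (L : P → Prop)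
    {X : P → ℕ} (hr : N.Reach M X) : ∃ Y, N.Reach M Y ∧ (∀ p, L p → X p ≤ Y p) ∧
      (Y = clusterMrk C ∨ ∃ t p, N.enabled Y t ∧ L p ∧ p ∈ N.pre t) := by
  obtain ⟨l, hl⟩ := hc.2 X hr
  generalize clusterMrk C = Z at hl
  induction hl with
  | nil X => exact ⟨X, hr, fun _ _ => le_rfl, Or.inl rfl⟩
  | @cons X t σ Z he _ ih =>
    by_cases h : ∃ p, L p ∧ p ∈ N.pre t
    · obtain ⟨p, h1, h2⟩ := h
      exact ⟨X, hr, fun _ _ => le_rfl, Or.inr ⟨t, p, he, h1, h2⟩⟩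
    · obtain ⟨Y, h1, h2, h3⟩ := ih (hr.trans' (reach_fire he))
      exact ⟨Y, h1, fun p hp => (le_fire fun hpt => h ⟨p, hp, hpt⟩).trans (h2 p hp), h3⟩

theorem enabled_of_pre (hfc : N.FreeChoice) {X : P → ℕ} {t u : T} {p : P}
    (he : N.enabled X t) (h1 : p ∈ N.pre t) (h2 : p ∈ N.pre u) : N.enabled X u := by
  unfold enabled
  rw [← pre_eq hfc h1 h2]
  exact he

/-- Inner claim: no token on `p` together with a token on a later suffix `B`. -/
theorem inner (hp : N.Proper) (hfc : N.FreeChoice) {M : P → ℕ} {C : Set (P ⊕ T)}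
    (hc : N.HomeCluster M C) {p : P} (hpC : Sum.inl p ∉ C) (B : List P)
    (hchain : B.IsChain (fun a b => ∃ t, a ∈ N.pre t ∧ b ∈ N.post t))
    (hlast : ∀ r, B.getLast? = some r → Sum.inl r ∈ C)
    (hD : ∀ b ∈ B, N.cluster (Sum.inl p) ≠ N.cluster (Sum.inl b))
    (H : ∀ Y t b, N.Reach M Y → N.enabled Y t → p ∈ N.pre t → b ∈ B → 1 ≤ Y b → False) :
    ∀ X, N.Reach M X → 1 ≤ X p → ∀ b ∈ B, 1 ≤ X b → False := by
  induction B with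
  | nil => intro X _ _ b hb; simp at hb
  | cons b B ih =>
    have ih' := ih hchain.tail
      (by
        intro r hr
        apply hlast r
        cases B with
        | nil => simp at hr
        | cons c B => simpa using hr)
      (fun c hcB => hD c (by simp [hcB]))
      (fun Y t c h1 h2 h3 h4 => H Y t c h1 h2 h3 (by simp [h4]))
    intro X hr hXp c hcB hXc
    rcases List.mem_cons.1 hcB with rfl | hcB
    · obtain ⟨Y, hY, hle, h⟩ := advance hc (fun q => q = p ∨ q = c) hr
      have hYp := hXp.trans (hle p (Or.inl rfl))
      have hYc := hXc.trans (hle c (Or.inr rfl))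
      rcases h with h | ⟨t, q, he, hq, hqt⟩
      · rw [h] at hYp
        simp [clusterMrk, hpC] at hYp
      · rcases hq with rfl | rfl
        · exact H Y t c hY he hqt (by simp) hYc
        · cases B with
          | nil =>
            have hqC := hlast q (by simp)
            have := eq_of_cover hp hfc hc hY (cover_of_enabled hfc hc.1 he hqt hqC) p
            simp [clusterMrk, hpC] at this
            omega
          | cons d B =>
            obtain ⟨u, hu1, hu2⟩ := (List.isChain_cons_cons.1 hchain).1
            have heu := enabled_of_pre hfc he hqt hu1
            refine ih' _ (hY.trans' (reach_fire heu)) (hYp.trans (le_fire ?_)) d (by simp)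
              (one_le_fire hu2)
            exact fun h => not_pre_of_ne (hD q (by simp)) h hu1
    · exact ih' X hr hXp c hcB hXc

theorem sum_pos_exists {X : P → ℕ} (L : List P) (h : 1 ≤ (L.map X).sum) :
    ∃ b ∈ L, 1 ≤ X b := by
  by_contra hcon
  push Not at hcon
  have : (L.map X).sum = 0 := by
    apply List.sum_eq_zero
    intro x hx
    obtain ⟨b, hb, rfl⟩ := List.mem_map.1 hx
    have := hcon b hb
    omega
  omega

theorem le_sum {X : P → ℕ} {L : List P} {b : P} (h : b ∈ L) : X b ≤ (L.map X).sum :=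
  List.le_sum_of_mem (List.mem_map.2 ⟨b, h, rfl⟩)

theorem main_aux (hp : N.Proper) (hfc : N.FreeChoice) {M : P → ℕ} {C : Set (P ⊕ T)}
    (hc : N.HomeCluster M C) (L : List P)
    (hchain : L.IsChain (fun a b => ∃ t, a ∈ N.pre t ∧ b ∈ N.post t))
    (hlast : ∀ r, L.getLast? = some r → Sum.inl r ∈ C)
    (hD : L.Pairwise (fun a b => N.cluster (Sum.inl a) ≠ N.cluster (Sum.inl b))) :
    ∀ X, N.Reach M X → (L.map X).sum ≤ 1 := by
  induction L with
  | nil => intro X _; simp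
  | cons p L ih =>
    intro X hr
    cases L with
    | nil =>
      have hpC := hlast p (by simp)
      by_contra hcon
      simp at hcon
      obtain ⟨Y, hY, hle, h⟩ := advance hc (fun q => q = p) hr
      have hYp := hle p rfl
      have hm : clusterMrk C p = 1 := by simp [clusterMrk, hpC]
      rcases h with h | ⟨t, q, he, rfl, hqt⟩
      · rw [h] at hYp
        omega
      · have := eq_of_cover hp hfc hc hY (cover_of_enabled hfc hc.1 he hqt hpC) q
        omega
    | cons q L =>
      have hlast' : ∀ r, (q :: L).getLast? = some r → Sum.inl r ∈ C := by
        intro r hr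
        exact hlast r (by simpa using hr)
      have hD1 := (List.pairwise_cons.1 hD).1
      have ih' := ih hchain.tail hlast' (List.pairwise_cons.1 hD).2
      obtain ⟨u, hu1, hu2⟩ := (List.isChain_cons_cons.1 hchain).1
      have hpC : Sum.inl p ∉ C := by
        have hl := List.getLast?_eq_some_getLast (l := q :: L) (by simp)
        exact not_mem_of_ne hc.1 (hD1 _ (List.getLast_mem (by simp))) (hlast' _ hl)
      have hnot : ∀ b ∈ q :: L, b ∉ N.pre u := fun b hb => not_pre_of_ne (hD1 b hb) hu1
      have H : ∀ Y t b, N.Reach M Y → N.enabled Y t → p ∈ N.pre t → b ∈ q :: L → 1 ≤ Y b →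
          False := by
        intro Y t b hY he hpt hb hYb
        have heu := enabled_of_pre hfc he hpt hu1
        have h1 := ih' _ (hY.trans' (reach_fire heu))
        have h2 := lt_fire (X := Y) (hnot q (by simp)) hu2
        simp only [List.map_cons, List.sum_cons] at h1
        rcases List.mem_cons.1 hb with rfl | hbL
        · omega
        · have h3 := le_sum (X := N.fire Y u) hbL
          have h4 := le_fire (X := Y) (hnot b hb)
          omega
      have hin := inner hp hfc hc hpC (q :: L) hchain.tail hlast' hD1 H
      have hs := ih' X hr
      by_contra hcon
      rw [List.map_cons, List.sum_cons] at hcon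
      by_cases h0 : 1 ≤ ((q :: L).map X).sum
      · obtain ⟨b, hb, hXb⟩ := sum_pos_exists _ h0
        exact hin X hr (by omega) b hb hXb
      · have hXp : 2 ≤ X p := by omega
        obtain ⟨Y, hY, hle, h⟩ := advance hc (fun x => x = p) hr
        have hYp := hXp.trans (hle p rfl)
        rcases h with h | ⟨t, x, he, rfl, hxt⟩
        · rw [h] at hYp
          simp [clusterMrk, hpC] at hYp
        · have heu := enabled_of_pre hfc he hxt hu1
          have := pred_le_fire (N := N) (X := Y) (t := u) (p := x)
          exact hin _ (hY.trans' (reach_fire heu)) (by omega) q (by simp) (one_le_fire hu2)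

theorem chain_of_path : ∀ (ps : List P) (ts : List T), N.IsDisPath ps ts →
    ps.IsChain (fun a b => ∃ t, a ∈ N.pre t ∧ b ∈ N.post t) := by
  intro ps ts h
  rw [List.isChain_iff_getElem]
  intro i hi
  have hlen := h.1
  have hit : i < ts.length := by omega
  exact ⟨ts[i], h.2.1 i ts[i] _ _ (by simp [hit])
    (List.getElem?_eq_getElem (by omega)) (List.getElem?_eq_getElem hi)⟩

end Helpers

end PetriNet

/-- In a marked proper free-choice net with a home cluster C,
every C-rooted disentangled path is safe: any reachable marking puts at most
one token in total on its places. -/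
theorem rooted_disentangled_paths_safe {P T : Type} [DecidableEq P]
    (N : PetriNet P T) (M : P → ℕ) (C : Set (P ⊕ T))
    (hp : N.Proper) (hfc : N.FreeChoice) (hc : N.HomeCluster M C)
    (M' : P → ℕ) (hr : N.Reach M M') (ps : List P) (ts : List T)
    (hd : N.IsDisPath ps ts)
    (hroot : ∃ r, ps.getLast? = some r ∧ Sum.inl r ∈ C) :
    (ps.map M').sum ≤ 1 := by
  obtain ⟨r, hr1, hr2⟩ := hroot
  refine PetriNet.main_aux hp hfc hc ps (PetriNet.chain_of_path ps ts hd) ?_ hd.2.2 M' hr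
  intro x hx
  rw [hr1] at hx
  obtain rfl := Option.some.inj hx
  exact hr2
end
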